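/- arXiv:1704.07369 — 6 statements merged into one kernel-verified Lean document; each statement's English description precedes it below -/
import Mathlib

section
/- Let X be a finite set, let A : X⁴ → ℝ have all coefficients non-negative (A_{pq}^{rs} ≥ 0 for all p,q,r,s ∈ X), and let τ > 0. If F : [0,τ] → (X → ℝ) is continuously differentiable, solves the discrete velocity system dF_r/dt (t) = Q_r(F(t)) for all t ∈ [0,τ] and r ∈ X, and satisfies F_r(0) ≥ 0 for all r ∈ X, then F_r(t) ≥ 0 for all t ∈ [0,τ] and all r ∈ X (preservation of non-negativity). -/
open scoped BigOperators

/-- The square of the negative part is differentiable. -/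
lemma hasDerivAt_max_neg_zero_sq (x : ℝ) :
    HasDerivAt (fun y : ℝ => (max (-y) 0) ^ 2) (-2 * max (-x) 0) x := by
  rw [hasDerivAt_iff_isLittleO]
  refine Asymptotics.IsBigO.trans_isLittleO (g := fun y : ℝ => (y - x) ^ 2) ?_ ?_
  · refine Asymptotics.IsBigO.of_bound 1 (Filter.Eventually.of_forall fun y => ?_)
    rw [one_mul, Real.norm_eq_abs, Real.norm_eq_abs, abs_of_nonneg (sq_nonneg (y - x)),
      smul_eq_mul, abs_le]
    rcases max_cases (-y) 0 with ⟨h1, h1'⟩ | ⟨h1, h1'⟩ <;>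
    rcases max_cases (-x) 0 with ⟨h2, h2'⟩ | ⟨h2, h2'⟩ <;>
    rw [h1, h2] <;> constructor <;> nlinarith
  · simpa using Asymptotics.isLittleO_pow_sub_sub x one_lt_two

lemma neg_mul_add_le_mul {M a b : ℝ} (ha : |a| ≤ M) (hb : |b| ≤ M) :
    -(M * (max (-a) 0 + max (-b) 0)) ≤ a * b := by
  obtain ⟨ha1, ha2⟩ := abs_le.1 ha
  obtain ⟨hb1, hb2⟩ := abs_le.1 hb
  rcases max_cases (-a) 0 with ⟨h1, h1'⟩ | ⟨h1, h1'⟩ <;>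
  rcases max_cases (-b) 0 with ⟨h2, h2'⟩ | ⟨h2, h2'⟩ <;>
  rw [h1, h2] <;> nlinarith

/-- A single collision term pairs with the negative part of `c` to at least `-3 M φ`, where `φ`
dominates the squared negative parts. -/
lemma neg_three_mul_le_negPart_mul_collision {M φ a b c d : ℝ}
    (ha : |a| ≤ M) (hb : |b| ≤ M) (hd : |d| ≤ M)
    (ha' : (max (-a) 0) ^ 2 ≤ φ) (hb' : (max (-b) 0) ^ 2 ≤ φ) (hc' : (max (-c) 0) ^ 2 ≤ φ) :
    -(3 * M * φ) ≤ max (-c) 0 * (a * b - c * d) := by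
  have hM : 0 ≤ M := (abs_nonneg a).trans ha
  have hab := neg_mul_add_le_mul ha hb
  have hc : max (-c) 0 * c = -(max (-c) 0) ^ 2 := by
    rcases max_cases (-c) 0 with ⟨h, -⟩ | ⟨h, -⟩ <;> rw [h] <;> ring
  have hc0 : 0 ≤ max (-c) 0 := le_max_right _ _
  generalize max (-c) 0 = u at *
  generalize max (-a) 0 = v at *
  generalize max (-b) 0 = w at *
  have h1 : u * v ≤ φ := by nlinarith [sq_nonneg (u - v)]
  have h2 : u * w ≤ φ := by nlinarith [sq_nonneg (u - w)]
  have h3 : -(M * φ) ≤ u ^ 2 * d := by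
    nlinarith [mul_le_mul_of_nonneg_left (abs_le.1 hd).1 (sq_nonneg u),
      mul_le_mul_of_nonneg_left hc' hM]
  have h4 := mul_le_mul_of_nonneg_left hab hc0
  have h5 := mul_le_mul_of_nonneg_left h1 hM
  have h6 := mul_le_mul_of_nonneg_left h2 hM
  have h7 : u * (a * b - c * d) = u * (a * b) + u ^ 2 * d := by linear_combination -d * hc
  rw [h7]
  linarith

/-- A differential form of Grönwall's inequality with zero initial value. -/
lemma nonpos_of_hasDerivWithinAt_le_mul {τ K : ℝ} {φ φ' : ℝ → ℝ}
    (hφ : ∀ t ∈ Set.Icc 0 τ, HasDerivWithinAt φ (φ' t) (Set.Icc 0 τ) t)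
    (hle : ∀ t ∈ Set.Icc 0 τ, φ' t ≤ K * φ t) (h0 : φ 0 ≤ 0) :
    ∀ t ∈ Set.Icc 0 τ, φ t ≤ 0 := by
  have hd : ∀ t ∈ Set.Icc 0 τ, HasDerivWithinAt (fun u => φ u * Real.exp (-K * u))
      (φ' t * Real.exp (-K * t) + φ t * (Real.exp (-K * t) * -K)) (Set.Icc 0 τ) t := by
    intro t ht
    have he : HasDerivAt (fun u => Real.exp (-K * u)) (Real.exp (-K * t) * -K) t := by
      simpa using ((hasDerivAt_id t).const_mul (-K)).exp
    exact (hφ t ht).mul he.hasDerivWithinAt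
  have hanti : AntitoneOn (fun u => φ u * Real.exp (-K * u)) (Set.Icc 0 τ) := by
    refine antitoneOn_of_hasDerivWithinAt_nonpos (convex_Icc 0 τ)
      (fun t ht => (hd t ht).continuousWithinAt)
      (fun t ht => (hd t (interior_subset ht)).mono interior_subset) fun t ht => ?_
    have := mul_nonneg (sub_nonneg.2 (hle t (interior_subset ht))) (Real.exp_pos (-K * t)).le
    linarith
  intro t ht
  have h := hanti ⟨le_rfl, ht.1.trans ht.2⟩ ht ht.1
  simp only [mul_zero, Real.exp_zero, mul_one] at h
  exact nonpos_of_mul_nonpos_left (h.trans h0) (Real.exp_pos _)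

theorem dvm_positivity_preservation {X : Type*} [Fintype X]
    (A : X → X → X → X → ℝ)
    (hpos : ∀ p q r s : X, 0 ≤ A p q r s)
    (τ : ℝ) (hτ : 0 < τ)
    (F : ℝ → X → ℝ)
    (hcont : ∀ r : X, ContinuousOn (fun u => F u r) (Set.Icc (0 : ℝ) τ))
    (hode : ∀ t ∈ Set.Icc (0 : ℝ) τ, ∀ r : X,
      HasDerivWithinAt (fun u => F u r)
        (∑ p : X, ∑ q : X, ∑ s : X, A p q r s * (F t p * F t q - F t r * F t s))
        (Set.Icc (0 : ℝ) τ) t)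
    (hinit : ∀ r : X, 0 ≤ F 0 r) :
    ∀ t ∈ Set.Icc (0 : ℝ) τ, ∀ r : X, 0 ≤ F t r := by
  obtain ⟨M, hM⟩ := isCompact_Icc.exists_bound_of_continuousOn (continuousOn_pi.2 hcont)
  have hM' : ∀ t ∈ Set.Icc 0 τ, ∀ r, |F t r| ≤ M := fun t ht r =>
    (norm_le_pi_norm (F t) r).trans (hM t ht)
  have hsingle : ∀ t r, (max (-F t r) 0) ^ 2 ≤ ∑ r, (max (-F t r) 0) ^ 2 := fun t r =>
    Finset.single_le_sum (f := fun r => (max (-F t r) 0) ^ 2)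
      (fun _ _ => sq_nonneg _) (Finset.mem_univ r)
  have key := nonpos_of_hasDerivWithinAt_le_mul (φ := fun t => ∑ r, (max (-F t r) 0) ^ 2)
    (K := ∑ r, ∑ p, ∑ q, ∑ s, A p q r s * (6 * M))
    (fun t ht => HasDerivWithinAt.fun_sum fun r _ =>
      (hasDerivAt_max_neg_zero_sq (F t r)).comp_hasDerivWithinAt t (hode t ht r))
    (fun t ht => by
      have hφ := hsingle t
      generalize ∑ r, (max (-F t r) 0) ^ 2 = φ at hφ ⊢
      simp only [Finset.sum_mul, Finset.mul_sum]
      refine Finset.sum_le_sum fun r _ => Finset.sum_le_sum fun p _ =>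
        Finset.sum_le_sum fun q _ => Finset.sum_le_sum fun s _ => ?_
      have h := mul_le_mul_of_nonneg_left (neg_three_mul_le_negPart_mul_collision
        (hM' t ht p) (hM' t ht q) (hM' t ht s) (hφ p) (hφ q) (hφ r))
        (hpos p q r s)
      linarith)
    (by simp [hinit])
  intro t ht r
  have h : (max (-F t r) 0) ^ 2 ≤ 0 := (hsingle t r).trans (key t ht)
  have h' : max (-F t r) 0 = 0 := pow_eq_zero_iff two_ne_zero |>.1 (le_antisymm h (sq_nonneg _))
  linarith [le_max_left (-F t r) 0]
end

section
/- Let X be a finite set, let A : X⁴ → ℝ satisfy the symmetry condition A_{pq}^{rs} = A_{qp}^{rs} and A_{pq}^{rs} = A_{rs}^{pq} and have all coefficients non-negative (A_{pq}^{rs} ≥ 0), and let τ > 0. If F : [0,τ] → (X → ℝ) is differentiable, solves dF_r/dt (t) = Q_r(F(t)) for all t ∈ [0,τ] and r ∈ X, and satisfies F_r(t) > 0 for all t ∈ [0,τ] and r ∈ X, then the discrete entropy η(t) = Σ_{r∈X} F_r(t) ln F_r(t) is non-increasing on [0,τ]: for all 0 ≤ t₁ ≤ t₂ ≤ τ, η(t₂)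 ≤ η(t₁) (discrete H-theorem). -/
open scoped BigOperators

theorem sum_four_swap_pairs {X M : Type*} [Fintype X] [AddCommMonoid M] (f : X → X → X → X → M) :
    ∑ p, ∑ q, ∑ r, ∑ s, f p q r s = ∑ p, ∑ q, ∑ r, ∑ s, f r s p q := by
  calc ∑ p, ∑ q, ∑ r, ∑ s, f p q r s
      = ∑ p, ∑ r, ∑ q, ∑ s, f p q r s := Finset.sum_congr rfl fun _ _ => Finset.sum_comm
    _ = ∑ r, ∑ p, ∑ q, ∑ s, f p q r s := Finset.sum_comm
    _ = ∑ r, ∑ p, ∑ s, ∑ q, f p q r s :=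
        Finset.sum_congr rfl fun _ _ => Finset.sum_congr rfl fun _ _ => Finset.sum_comm
    _ = ∑ r, ∑ s, ∑ p, ∑ q, f p q r s := Finset.sum_congr rfl fun _ _ => Finset.sum_comm

/-- The weak form of the collision operator: testing against `φ` symmetrizes over the four slots. -/
theorem four_mul_sum_mul_eq_sum_symmetrized {X : Type*} [Fintype X] (W : X → X → X → X → ℝ)
    (hswap : ∀ p q r s, W p q r s = W q p r s) (hanti : ∀ p q r s, W r s p q = -W p q r s)
    (φ : X → ℝ) :
    4 * ∑ p, ∑ q, ∑ r, ∑ s, W p q r s * φ r =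
      ∑ p, ∑ q, ∑ r, ∑ s, W p q r s * (φ r + φ s - φ p - φ q) := by
  have hp : ∑ p, ∑ q, ∑ r, ∑ s, W p q r s * φ p = -∑ p, ∑ q, ∑ r, ∑ s, W p q r s * φ r := by
    rw [sum_four_swap_pairs]
    simp only [← Finset.sum_neg_distrib]
    exact Finset.sum_congr rfl fun p _ => Finset.sum_congr rfl fun q _ =>
      Finset.sum_congr rfl fun r _ => Finset.sum_congr rfl fun s _ => by rw [hanti, neg_mul]
  have hq : ∑ p, ∑ q, ∑ r, ∑ s, W p q r s * φ q = ∑ p, ∑ q, ∑ r, ∑ s, W p q r s * φ p := by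
    rw [Finset.sum_comm]
    exact Finset.sum_congr rfl fun q _ => Finset.sum_congr rfl fun p _ =>
      Finset.sum_congr rfl fun r _ => Finset.sum_congr rfl fun s _ => by rw [hswap]
  have hs : ∑ p, ∑ q, ∑ r, ∑ s, W p q r s * φ s = -∑ p, ∑ q, ∑ r, ∑ s, W p q r s * φ q := by
    rw [sum_four_swap_pairs]
    simp only [← Finset.sum_neg_distrib]
    exact Finset.sum_congr rfl fun p _ => Finset.sum_congr rfl fun q _ =>
      Finset.sum_congr rfl fun r _ => Finset.sum_congr rfl fun s _ => by rw [hanti, neg_mul]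
  simp only [mul_sub, mul_add, Finset.sum_sub_distrib, Finset.sum_add_distrib]
  linarith

theorem sub_mul_log_sub_log_nonpos {x y : ℝ} (hx : 0 < x) (hy : 0 < y) :
    (x - y) * (Real.log y - Real.log x) ≤ 0 := by
  rcases le_total x y with h | h
  · exact mul_nonpos_of_nonpos_of_nonneg (sub_nonpos.2 h) (sub_nonneg.2 (Real.log_le_log hx h))
  · exact mul_nonpos_of_nonneg_of_nonpos (sub_nonneg.2 h) (sub_nonpos.2 (Real.log_le_log hy h))

theorem entropy_production_nonpos {X : Type*} [Fintype X] (A : X → X → X → X → ℝ)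
    (hsym1 : ∀ p q r s : X, A p q r s = A q p r s)
    (hsym2 : ∀ p q r s : X, A p q r s = A r s p q)
    (hpos : ∀ p q r s : X, 0 ≤ A p q r s) (f : X → ℝ) (hf : ∀ r, 0 < f r) :
    ∑ r, (∑ p, ∑ q, ∑ s, A p q r s * (f p * f q - f r * f s)) * (Real.log (f r) + 1) ≤ 0 := by
  have key := four_mul_sum_mul_eq_sum_symmetrized
    (fun p q r s => A p q r s * (f p * f q - f r * f s))
    (fun p q r s => by simp only [hsym1 p q r s, mul_comm (f p)])
    (fun p q r s => by simp only [← hsym2 p q r s]; ring) (fun r => Real.log (f r) + 1)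
  have hsum : ∑ p, ∑ q, ∑ r, ∑ s, A p q r s * (f p * f q - f r * f s) *
      ((Real.log (f r) + 1) + (Real.log (f s) + 1) - (Real.log (f p) + 1) - (Real.log (f q) + 1))
      ≤ 0 := by
    refine Finset.sum_nonpos fun p _ => Finset.sum_nonpos fun q _ =>
      Finset.sum_nonpos fun r _ => Finset.sum_nonpos fun s _ => ?_
    have h := sub_mul_log_sub_log_nonpos (mul_pos (hf p) (hf q)) (mul_pos (hf r) (hf s))
    rw [Real.log_mul (hf p).ne' (hf q).ne', Real.log_mul (hf r).ne' (hf s).ne'] at h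
    linarith [mul_nonpos_of_nonneg_of_nonpos (hpos p q r s) h]
  have hcomm : ∑ r, (∑ p, ∑ q, ∑ s, A p q r s * (f p * f q - f r * f s)) * (Real.log (f r) + 1) =
      ∑ p, ∑ q, ∑ r, ∑ s, A p q r s * (f p * f q - f r * f s) * (Real.log (f r) + 1) := by
    simp only [Finset.sum_mul]
    rw [Finset.sum_comm]
    exact Finset.sum_congr rfl fun _ _ => Finset.sum_comm
  rw [hcomm]
  linarith

theorem dvm_H_theorem {X : Type*} [Fintype X]
    (A : X → X → X → X → ℝ)
    (hsym1 : ∀ p q r s : X, A p q r s = A q p r s)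
    (hsym2 : ∀ p q r s : X, A p q r s = A r s p q)
    (hpos : ∀ p q r s : X, 0 ≤ A p q r s)
    (τ : ℝ) (hτ : 0 < τ)
    (F : ℝ → X → ℝ)
    (hode : ∀ t ∈ Set.Icc (0 : ℝ) τ, ∀ r : X,
      HasDerivWithinAt (fun u => F u r)
        (∑ p : X, ∑ q : X, ∑ s : X, A p q r s * (F t p * F t q - F t r * F t s))
        (Set.Icc (0 : ℝ) τ) t)
    (hF : ∀ t ∈ Set.Icc (0 : ℝ) τ, ∀ r : X, 0 < F t r) :
    ∀ t₁ ∈ Set.Icc (0 : ℝ) τ, ∀ t₂ ∈ Set.Icc (0 : ℝ) τ, t₁ ≤ t₂ →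
      ∑ r : X, F t₂ r * Real.log (F t₂ r) ≤ ∑ r : X, F t₁ r * Real.log (F t₁ r) := by
  have hderiv : ∀ t ∈ Set.Icc (0 : ℝ) τ,
      HasDerivWithinAt (fun u => ∑ r, F u r * Real.log (F u r))
        (∑ r, (∑ p, ∑ q, ∑ s, A p q r s * (F t p * F t q - F t r * F t s)) *
          (Real.log (F t r) + 1)) (Set.Icc (0 : ℝ) τ) t := fun t ht =>
    HasDerivWithinAt.fun_sum fun r _ => by
      rw [mul_comm]
      exact (Real.hasDerivAt_mul_log (hF t ht r).ne').comp_hasDerivWithinAt t (hode t ht r)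
  have hanti : AntitoneOn (fun u => ∑ r, F u r * Real.log (F u r)) (Set.Icc (0 : ℝ) τ) :=
    antitoneOn_of_hasDerivWithinAt_nonpos (convex_Icc 0 τ)
      (fun t ht => (hderiv t ht).continuousWithinAt)
      (fun t ht => (hderiv t (interior_subset ht)).mono interior_subset)
      (fun t ht => entropy_production_nonpos A hsym1 hsym2 hpos (F t) (hF t (interior_subset ht)))
  exact fun t₁ h₁ t₂ h₂ h => hanti h₁ h₂ h
end

section
/- With the discrete Fourier setup and the coefficients A_{pq}^{rs} defined from the symmetric kernel modes B̂, for every F : K → ℂ and every r ∈ K, the gain part of the Fourier collocation collision term can be written in discrete-velocity form: Σ_{p,q,s∈K} A_{pq}^{rs} F_p F_q = Σ_{l,m∈K} B̂(l,m) F̂_l F̂_m ω^{(l+m)·r}. -/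
open scoped BigOperators

noncomputable section

/-- The finite set of Fourier modes `K = {k ∈ ℤ^d : |k_i| ≤ n}`. -/
def K (d n : ℕ) : Finset (Fin d → ℤ) := Fintype.piFinset fun _ => Finset.Icc (-(n : ℤ)) n

/-- Integer dot product on `ℤ^d`. -/
def dotZ {d : ℕ} (k p : Fin d → ℤ) : ℤ := ∑ i, k i * p i

/-- The root of unity power `ω^a = exp(2πi a / N)`. -/
def ω (N : ℕ) (a : ℤ) : ℂ := Complex.exp (2 * Real.pi * Complex.I * a / N)

/-- The indicator `1_N(l)`, equal to `1` if `l ≡ 0 (mod N)` componentwise and `0` otherwise. -/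
def indN (N : ℕ) {d : ℕ} (l : Fin d → ℤ) : ℂ := if ∀ i, (N : ℤ) ∣ l i then 1 else 0

/-- The symmetric modulo map: the unique element of `K d n` congruent to `l` modulo `N = 2n+1`
componentwise. -/
def smod (n : ℕ) {d : ℕ} (l : Fin d → ℤ) : Fin d → ℤ :=
  fun i => (l i + n) % (2 * n + 1) - n

/-- Discrete Fourier coefficients `F̂_k = N^{-d} Σ_{p ∈ K} F_p ω^{-k·p}`. -/
def Fhat (d n : ℕ) (F : (Fin d → ℤ) → ℂ) (k : Fin d → ℤ) : ℂ :=
  ((2 * n + 1 : ℂ) ^ d)⁻¹ * ∑ p ∈ K d n, F p * ω (2 * n + 1) (-(dotZ k p))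

/-- The discrete-velocity-method coefficients `A_{pq}^{rs}` obtained from the kernel modes `B̂`. -/
def Acoef (d n : ℕ) (Bh : (Fin d → ℤ) → (Fin d → ℤ) → ℂ) (p q r s : Fin d → ℤ) : ℂ :=
  ((2 * n + 1 : ℂ) ^ (3 * d))⁻¹ *
    ∑ l ∈ K d n, ∑ m ∈ K d n, ∑ k ∈ K d n, ∑ j ∈ K d n,
      indN (2 * n + 1) (l + m - k - j) * Bh (smod n (l - j)) (smod n (m - j)) *
        ω (2 * n + 1) (-(dotZ l p)) * ω (2 * n + 1) (-(dotZ m q)) *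
        ω (2 * n + 1) (dotZ k r) * ω (2 * n + 1) (dotZ j s)

theorem ω_add (N : ℕ) (a b : ℤ) : ω N (a + b) = ω N a * ω N b := by
  simp only [ω, ← Complex.exp_add]
  congr 1
  push_cast
  ring

theorem ω_sum (N : ℕ) {ι : Type*} (s : Finset ι) (f : ι → ℤ) :
    ω N (∑ i ∈ s, f i) = ∏ i ∈ s, ω N (f i) := by
  simp only [ω, ← Complex.exp_sum]
  congr 1
  push_cast
  rw [Finset.mul_sum, Finset.sum_div]

theorem ω_natCast_mul (N : ℕ) (k : ℕ) (a : ℤ) : ω N (k * a) = ω N a ^ k := by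
  simp only [ω, ← Complex.exp_nat_mul]
  congr 1
  push_cast
  ring

theorem ω_eq_one_iff {N : ℕ} (hN : N ≠ 0) (a : ℤ) : ω N a = 1 ↔ (N : ℤ) ∣ a := by
  have hN' : (N : ℂ) ≠ 0 := by exact_mod_cast hN
  have hpi := Complex.two_pi_I_ne_zero
  rw [ω, Complex.exp_eq_one_iff]
  constructor
  · rintro ⟨k, hk⟩
    refine ⟨k, ?_⟩
    rw [div_eq_iff hN'] at hk
    have h : (a : ℂ) = N * k := mul_left_cancel₀ hpi (by linear_combination hk)
    exact_mod_cast h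
  · rintro ⟨k, rfl⟩
    refine ⟨k, ?_⟩
    push_cast
    field_simp

/-- `ω N` only depends on its argument modulo `N`. -/
theorem ω_congr {N : ℕ} (hN : N ≠ 0) {a b : ℤ} (h : (N : ℤ) ∣ a - b) : ω N a = ω N b := by
  rw [← sub_add_cancel a b, ω_add, (ω_eq_one_iff hN _).2 h, one_mul]

theorem mem_K {d n : ℕ} {k : Fin d → ℤ} : k ∈ K d n ↔ ∀ i, -(n : ℤ) ≤ k i ∧ k i ≤ n := by
  simp [K, Fintype.mem_piFinset]

theorem smod_mem_K {d : ℕ} (n : ℕ) (l : Fin d → ℤ) : smod n l ∈ K d n := by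
  refine mem_K.2 fun i => ?_
  have h0 := Int.emod_nonneg (l i + n) (b := 2 * n + 1) (by omega)
  have h1 := Int.emod_lt_of_pos (l i + n) (b := 2 * n + 1) (by omega)
  simp only [smod]
  omega

theorem smod_of_mem_K {d n : ℕ} {l : Fin d → ℤ} (hl : l ∈ K d n) : smod n l = l := by
  funext i
  have h := mem_K.1 hl i
  rw [smod, Int.emod_eq_of_lt (by omega) (by omega)]
  omega

theorem dvd_sub_smod {d : ℕ} (n : ℕ) (l : Fin d → ℤ) (i : Fin d) :
    ((2 * n + 1 : ℕ) : ℤ) ∣ l i - smod n l i := by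
  refine ⟨(l i + n) / (2 * n + 1), ?_⟩
  have h := Int.emod_add_mul_ediv (l i + n) (2 * n + 1)
  simp only [smod]
  push_cast
  linarith

theorem eq_smod_of_dvd {d n : ℕ} {k l : Fin d → ℤ} (hk : k ∈ K d n)
    (h : ∀ i, ((2 * n + 1 : ℕ) : ℤ) ∣ l i - k i) : k = smod n l := by
  rw [← smod_of_mem_K hk]
  funext i
  have h' : (k i + n) % (2 * n + 1) = (l i + n) % (2 * n + 1) := by
    refine Int.ModEq.eq (Int.modEq_iff_dvd.2 ?_)
    have := h i
    push_cast at this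
    rwa [add_sub_add_right_eq_sub]
  simp only [smod, h']

theorem sum_Icc_ω (n : ℕ) (a : ℤ) (ha : -(n : ℤ) ≤ a ∧ a ≤ n) :
    ∑ s ∈ Finset.Icc (-(n : ℤ)) n, ω (2 * n + 1) (a * s) =
      if a = 0 then (2 * n + 1 : ℂ) else 0 := by
  have hre : ∑ s ∈ Finset.Icc (-(n : ℤ)) n, ω (2 * n + 1) (a * s) =
      ∑ i ∈ Finset.range (2 * n + 1), ω (2 * n + 1) (-(n * a)) * ω (2 * n + 1) a ^ i := by
    symm
    refine Finset.sum_bij (fun i _ => (i : ℤ) - n) ?_ ?_ ?_ ?_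
    · intro i hi
      simp only [Finset.mem_range, Finset.mem_Icc] at hi ⊢
      omega
    · intro i _ j _ h
      simpa using h
    · intro s hs
      rw [Finset.mem_Icc] at hs
      exact ⟨(s + n).toNat, by rw [Finset.mem_range]; omega, by omega⟩
    · intro i _
      rw [← ω_natCast_mul, ← ω_add]
      congr 1
      ring
  rw [hre, ← Finset.mul_sum]
  split_ifs with h
  · subst h
    simp [ω]
  · have hne : ω (2 * n + 1) a ≠ 1 := by
      rw [Ne, ω_eq_one_iff (by omega)]
      intro hdvd
      exact h (Int.eq_zero_of_abs_lt_dvd hdvd (by rw [abs_lt]; push_cast; omega))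
    have hpow : ω (2 * n + 1) a ^ (2 * n + 1) = 1 := by
      rw [← ω_natCast_mul, ω_eq_one_iff (by omega)]
      exact dvd_mul_right _ _
    rw [geom_sum_eq hne, hpow, sub_self, zero_div, mul_zero]

/-- Orthogonality of the discrete characters. -/
theorem sum_K_ω {d n : ℕ} {j : Fin d → ℤ} (hj : j ∈ K d n) :
    ∑ s ∈ K d n, ω (2 * n + 1) (dotZ j s) = if j = 0 then (2 * n + 1 : ℂ) ^ d else 0 := by
  simp only [dotZ, ω_sum, K]
  rw [← Finset.prod_univ_sum (fun _ => Finset.Icc (-(n : ℤ)) n)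
    (fun i x => ω (2 * n + 1) (j i * x))]
  rw [Finset.prod_congr rfl fun i _ => sum_Icc_ω n (j i) (mem_K.1 hj i)]
  split_ifs with h
  · simp [h]
  · obtain ⟨i, hi⟩ := Function.ne_iff.1 h
    exact Finset.prod_eq_zero (Finset.mem_univ i) (if_neg hi)

theorem ω_dotZ_smod {d : ℕ} (n : ℕ) (l r : Fin d → ℤ) :
    ω (2 * n + 1) (dotZ (smod n l) r) = ω (2 * n + 1) (dotZ l r) := by
  refine (ω_congr (by omega) ?_).symm
  rw [dotZ, dotZ, ← Finset.sum_sub_distrib]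
  refine Finset.dvd_sum fun i _ => ?_
  rw [← sub_mul]
  exact (dvd_sub_smod n l i).mul_right _

theorem sum_K_indN_mul_ω {d : ℕ} (n : ℕ) (l r : Fin d → ℤ) :
    ∑ k ∈ K d n, indN (2 * n + 1) (l - k) * ω (2 * n + 1) (dotZ k r) =
      ω (2 * n + 1) (dotZ l r) := by
  rw [Finset.sum_eq_single_of_mem (smod n l) (smod_mem_K n l)]
  · simp only [indN, Pi.sub_apply]
    rw [if_pos (dvd_sub_smod n l), one_mul, ω_dotZ_smod]
  · intro k hk hne
    simp only [indN, Pi.sub_apply]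
    rw [if_neg fun h => hne (eq_smod_of_dvd hk h), zero_mul]

theorem sum_Acoef {d n : ℕ} (Bh : (Fin d → ℤ) → (Fin d → ℤ) → ℂ) (p q r : Fin d → ℤ) :
    ∑ s ∈ K d n, Acoef d n Bh p q r s =
      ((2 * n + 1 : ℂ) ^ (3 * d))⁻¹ * (2 * n + 1 : ℂ) ^ d * ∑ l ∈ K d n, ∑ m ∈ K d n,
        Bh l m * ω (2 * n + 1) (-(dotZ l p)) * ω (2 * n + 1) (-(dotZ m q)) *
          ω (2 * n + 1) (dotZ (l + m) r) := by
  have h0 : (0 : Fin d → ℤ) ∈ K d n := mem_K.2 fun i => by simp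
  simp only [Acoef]
  rw [← Finset.mul_sum, mul_assoc, Finset.mul_sum _ _ ((2 * n + 1 : ℂ) ^ d), Finset.sum_comm]
  congr 1
  refine Finset.sum_congr rfl fun l hl => ?_
  rw [Finset.mul_sum, Finset.sum_comm]
  refine Finset.sum_congr rfl fun m hm => ?_
  rw [← sum_K_indN_mul_ω n (l + m) r, Finset.mul_sum, Finset.mul_sum, Finset.sum_comm]
  refine Finset.sum_congr rfl fun k _ => ?_
  rw [Finset.sum_comm, Finset.sum_eq_single_of_mem 0 h0]
  · rw [← Finset.mul_sum, sum_K_ω h0, if_pos rfl]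
    simp only [sub_zero, smod_of_mem_K hl, smod_of_mem_K hm]
    ring
  · intro j hj hne
    rw [← Finset.mul_sum, sum_K_ω hj, if_neg hne, mul_zero]

/-- Gain part of the Fourier collocation collision term in discrete-velocity form. -/
theorem fcm_gain_dvm_form (d n : ℕ) (hd : 1 ≤ d) (hn : 1 ≤ n)
    (Bh : (Fin d → ℤ) → (Fin d → ℤ) → ℂ)
    (hsym1 : ∀ l ∈ K d n, ∀ m ∈ K d n, Bh l m = Bh m l)
    (hsym2 : ∀ l ∈ K d n, ∀ m ∈ K d n, Bh l m = Bh l (-m))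
    (F : (Fin d → ℤ) → ℂ) (r : Fin d → ℤ) (hr : r ∈ K d n) :
    ∑ p ∈ K d n, ∑ q ∈ K d n, ∑ s ∈ K d n, Acoef d n Bh p q r s * F p * F q
      = ∑ l ∈ K d n, ∑ m ∈ K d n,
          Bh l m * Fhat d n F l * Fhat d n F m * ω (2 * n + 1) (dotZ (l + m) r) := by
  have hN : (2 * n + 1 : ℂ) ≠ 0 := by exact_mod_cast (by omega : 2 * n + 1 ≠ 0)
  have hc : ((2 * n + 1 : ℂ) ^ (3 * d))⁻¹ * (2 * n + 1 : ℂ) ^ d =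
      ((2 * n + 1 : ℂ) ^ d)⁻¹ * ((2 * n + 1 : ℂ) ^ d)⁻¹ := by
    rw [mul_comm 3 d, pow_mul]
    field_simp
  simp only [← Finset.sum_mul, sum_Acoef, hc, Fhat]
  simp only [Finset.mul_sum, Finset.sum_mul]
  simp only [← Finset.sum_product' (K d n) (K d n)]
  rw [Finset.sum_comm]
  refine Finset.sum_congr rfl fun x _ => ?_
  rw [Finset.sum_product, Finset.sum_product, Finset.sum_comm]
  refine Finset.sum_congr rfl fun p _ => Finset.sum_congr rfl fun q _ => ?_
  ring
end
end

section
/- For every integer n ≥ 1 and every θ ∈ ℝ, the modified Jackson kernel is non-negative: Σ_{β=−n}^{n} σ_n(β) e^{iβθ} is a real number and Σ_{β=−n}^{n} σ_n(β) e^{iβθ} ≥ 0 (equivalently, σ_n(0) + 2 Σ_{β=1}^{n} σ_n(β) cos(βθ) ≥ 0). -/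
open scoped BigOperators

noncomputable section

/-- The one-dimensional modified Jackson filter
`σ_n(β) = [(n+1−|β|) cos(π|β|/(n+1)) + sin(π|β|/(n+1)) cot(π/(n+1))] / (n+1)`. -/
def jackson (n : ℕ) (β : ℤ) : ℝ :=
  (((n : ℝ) + 1 - |(β : ℝ)|) * Real.cos (Real.pi * |(β : ℝ)| / ((n : ℝ) + 1))
      + Real.sin (Real.pi * |(β : ℝ)| / ((n : ℝ) + 1)) * Real.cot (Real.pi / ((n : ℝ) + 1)))
    / ((n : ℝ) + 1)

/-- Closed form of the partial autocorrelation sums of `k ↦ sin (k q)`. -/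
lemma four_mul_sin_mul_sum_sin_mul_sin (q b : ℝ) (m : ℕ) :
    4 * Real.sin q * ∑ k ∈ Finset.range m, Real.sin (k * q) * Real.sin ((k + b) * q) =
      2 * m * Real.cos (b * q) * Real.sin q
        - Real.sin ((2 * m - 1 + b) * q) + Real.sin ((b - 1) * q) := by
  induction m with
  | zero => simp [sub_eq_add_neg, add_comm]
  | succ m ih =>
    rw [Finset.sum_range_succ, mul_add, ih]
    push_cast
    have h₁ : (2 * ((m : ℝ) + 1) - 1 + b) * q = (m * q + (m + b) * q) + q := by ring
    have h₂ : (2 * (m : ℝ) - 1 + b) * q = (m * q + (m + b) * q) - q := by ring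
    have h₃ : b * q = (m + b) * q - m * q := by ring
    have h₄ : Real.cos (b * q) = Real.cos ((m + b) * q) * Real.cos (m * q)
        + Real.sin ((m + b) * q) * Real.sin (m * q) := by rw [h₃, Real.cos_sub]
    rw [h₁, h₂, Real.sin_add, Real.sin_sub, Real.cos_add, h₄]
    ring

/-- The Jackson filter is the normalized autocorrelation of the sequence `k ↦ sin (π k / (n + 1))`. -/
lemma jackson_natCast_eq_sum {n : ℕ} (hn : 1 ≤ n) {b : ℕ} (hb : b ≤ n) :
    jackson n b = 2 / ((n : ℝ) + 1) * ∑ k ∈ Finset.range (n + 1 - b),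
      Real.sin (k * (Real.pi / ((n : ℝ) + 1))) *
        Real.sin ((k + b) * (Real.pi / ((n : ℝ) + 1))) := by
  have hM : (0 : ℝ) < (n : ℝ) + 1 := by positivity
  set q : ℝ := Real.pi / ((n : ℝ) + 1) with hq
  have hn' : (1 : ℝ) ≤ n := by exact_mod_cast hn
  have hs : 0 < Real.sin q := by
    apply Real.sin_pos_of_pos_of_lt_pi (by positivity)
    rw [hq, div_lt_iff₀ hM]
    nlinarith [Real.pi_pos]
  have hqM : ((n : ℝ) + 1) * q = Real.pi := by rw [hq]; field_simp
  have h := four_mul_sin_mul_sum_sin_mul_sin q b (n + 1 - b)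
  have hc : ((n + 1 - b : ℕ) : ℝ) = (n : ℝ) + 1 - b := by
    rw [Nat.cast_sub (by omega)]; push_cast; ring
  have h₁ : (2 * ((n : ℝ) + 1 - b) - 1 + b) * q = 2 * Real.pi - (b * q + q) := by
    rw [← hqM]; ring
  have h₂ : ((b : ℝ) - 1) * q = b * q - q := by ring
  rw [hc, h₁, h₂, Real.sin_two_pi_sub, Real.sin_add, Real.sin_sub] at h
  have h₃ : Real.pi * (b : ℝ) / ((n : ℝ) + 1) = b * q := by rw [hq]; ring
  simp only [jackson, Int.cast_natCast, Nat.abs_cast, h₃, ← hq, Real.cot_eq_cos_div_sin]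
  generalize ∑ k ∈ Finset.range (n + 1 - b), Real.sin (k * q) * Real.sin ((k + b) * q) = S at h ⊢
  field_simp
  linarith

lemma jackson_neg (n : ℕ) (β : ℤ) : jackson n (-β) = jackson n β := by
  simp [jackson]

lemma jackson_eq_sum_filter {n : ℕ} (hn : 1 ≤ n) {β : ℤ} (hβ : β ∈ Finset.Icc (-(n : ℤ)) n) :
    jackson n β = 2 / ((n : ℝ) + 1) *
      ∑ p ∈ Finset.range (n + 1) ×ˢ Finset.range (n + 1) with (p.1 : ℤ) - p.2 = β,
        Real.sin (p.1 * (Real.pi / ((n : ℝ) + 1))) *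
          Real.sin (p.2 * (Real.pi / ((n : ℝ) + 1))) := by
  rw [Finset.mem_Icc] at hβ
  obtain ⟨b, rfl | rfl⟩ := Int.eq_nat_or_neg β
  · rw [jackson_natCast_eq_sum hn (by omega)]
    congr 1
    refine Finset.sum_nbij' (fun k => (k + b, k)) (fun p => p.2) ?_ ?_ ?_ ?_ ?_
    · intro k hk; simp at hk ⊢; omega
    · intro p hp; simp at hp ⊢; omega
    · intro k hk; rfl
    · rintro ⟨j, k⟩ hp; simp at hp ⊢; omega
    · intro k hk; push_cast; ring
  · rw [jackson_neg, jackson_natCast_eq_sum hn (by omega)]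
    congr 1
    refine Finset.sum_nbij' (fun k => (k, k + b)) (fun p => p.1) ?_ ?_ ?_ ?_ ?_
    · intro k hk; simp at hk ⊢; omega
    · intro p hp; simp at hp ⊢; omega
    · intro k hk; rfl
    · rintro ⟨j, k⟩ hp; simp at hp ⊢; omega
    · intro k hk; push_cast; ring

/-- The Jackson kernel is a squared modulus of a trigonometric polynomial. -/
lemma jackson_kernel_eq_normSq {n : ℕ} (hn : 1 ≤ n) (θ : ℝ) :
    ∑ β ∈ Finset.Icc (-(n : ℤ)) n,
        (jackson n β : ℂ) * Complex.exp (Complex.I * (β : ℂ) * (θ : ℂ)) =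
      ((2 / ((n : ℝ) + 1) * Complex.normSq (∑ k ∈ Finset.range (n + 1),
        (Real.sin (k * (Real.pi / ((n : ℝ) + 1))) : ℂ) *
          Complex.exp (Complex.I * k * θ)) : ℝ) : ℂ) := by
  have hmaps : ∀ p ∈ Finset.range (n + 1) ×ˢ Finset.range (n + 1),
      (p.1 : ℤ) - p.2 ∈ Finset.Icc (-(n : ℤ)) n := by
    intro p hp; simp at hp ⊢; omega
  rw [Complex.ofReal_mul, ← Complex.mul_conj, map_sum, Finset.sum_mul_sum,
    ← Finset.sum_product', ← Finset.sum_fiberwise_of_maps_to hmaps, Finset.mul_sum]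
  refine Finset.sum_congr rfl fun β hβ => ?_
  rw [jackson_eq_sum_filter hn hβ, Complex.ofReal_mul, mul_assoc, Complex.ofReal_sum,
    Finset.sum_mul]
  congr 1
  refine Finset.sum_congr rfl fun p hp => ?_
  obtain rfl := (Finset.mem_filter.mp hp).2
  have hexp : Complex.exp (Complex.I * (((p.1 : ℤ) - p.2 : ℤ) : ℂ) * θ) =
      Complex.exp (Complex.I * p.1 * θ) * Complex.exp (-Complex.I * p.2 * θ) := by
    rw [← Complex.exp_add]; push_cast; ring_nf
  rw [hexp, map_mul, Complex.conj_ofReal, ← Complex.exp_conj, map_mul, map_mul, Complex.conj_I,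
    Complex.conj_ofReal, Complex.conj_natCast, Complex.ofReal_mul]
  ring

/-- The modified Jackson kernel `Σ_{|β|≤n} σ_n(β) e^{iβθ}` is real and non-negative. -/
theorem jackson_kernel_nonneg (n : ℕ) (hn : 1 ≤ n) (θ : ℝ) :
    (∑ β ∈ Finset.Icc (-(n : ℤ)) n,
        (jackson n β : ℂ) * Complex.exp (Complex.I * (β : ℂ) * (θ : ℂ))).im = 0
      ∧ 0 ≤ (∑ β ∈ Finset.Icc (-(n : ℤ)) n,
          (jackson n β : ℂ) * Complex.exp (Complex.I * (β : ℂ) * (θ : ℂ))).re := by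
  rw [jackson_kernel_eq_normSq hn θ, Complex.ofReal_im, Complex.ofReal_re]
  exact ⟨rfl, mul_nonneg (by positivity) (Complex.normSq_nonneg _)⟩
end
end

section
/- There exists a constant C > 0, independent of n and β, such that for every integer n ≥ 1 and every integer β with |β| ≤ n, the modified Jackson filter satisfies 0 ≤ σ_n(β) ≤ 1 and 1 − σ_n(β) ≤ C β² / (n+1)². -/
open scoped BigOperators

noncomputable section

theorem nat_mul_cos_mul_sin_le_sin {h : ℝ} (h0 : 0 ≤ h) (m : ℕ) (hm : ((m : ℝ) + 1) * h ≤ Real.pi) :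
    (m : ℝ) * Real.cos (((m : ℝ) + 1) * h) * Real.sin h ≤ Real.sin ((m : ℝ) * h) := by
  induction m with
  | zero => simp
  | succ m ih =>
    push_cast at hm ⊢
    have hm0 : 0 ≤ (m : ℝ) * h := by positivity
    have ih' := ih (by linarith)
    have hs : 0 ≤ Real.sin h := Real.sin_nonneg_of_nonneg_of_le_pi h0 (by linarith)
    have hc : 0 ≤ Real.cos h :=
      Real.cos_nonneg_of_neg_pi_div_two_le_of_le (by linarith [Real.pi_pos]) (by linarith)
    have hle : Real.cos (((m : ℝ) + 1 + 1) * h) ≤ Real.cos ((m : ℝ) * h) :=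
      Real.cos_le_cos_of_nonneg_of_le_pi hm0 hm (by linarith)
    have e1 : Real.sin (((m : ℝ) + 1) * h)
        = Real.sin (m * h) * Real.cos h + Real.cos (m * h) * Real.sin h := by
      rw [← Real.sin_add]; ring_nf
    have e2 : Real.cos ((m : ℝ) * h) + Real.cos (((m : ℝ) + 1 + 1) * h)
        = 2 * (Real.cos (((m : ℝ) + 1) * h) * Real.cos h) := by
      rw [show (m : ℝ) * h = (m + 1) * h - h by ring,
        show ((m : ℝ) + 1 + 1) * h = (m + 1) * h + h by ring, Real.cos_sub, Real.cos_add]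
      ring
    have hprod : Real.cos (((m : ℝ) + 1 + 1) * h) ≤ Real.cos (((m : ℝ) + 1) * h) * Real.cos h := by
      linarith
    calc ((m : ℝ) + 1) * Real.cos (((m : ℝ) + 1 + 1) * h) * Real.sin h
        = m * Real.sin h * Real.cos (((m : ℝ) + 1 + 1) * h)
          + Real.cos (((m : ℝ) + 1 + 1) * h) * Real.sin h := by ring
      _ ≤ m * Real.sin h * (Real.cos (((m : ℝ) + 1) * h) * Real.cos h)
          + Real.cos (m * h) * Real.sin h := by gcongr
      _ = m * Real.cos (((m : ℝ) + 1) * h) * Real.sin h * Real.cos h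
          + Real.cos (m * h) * Real.sin h := by ring
      _ ≤ Real.sin (m * h) * Real.cos h + Real.cos (m * h) * Real.sin h := by gcongr
      _ = _ := e1.symm

theorem sin_nat_mul_le {h : ℝ} (m : ℕ) (hs : 0 ≤ Real.sin h) :
    Real.sin ((m : ℝ) * h) ≤ m * Real.sin h := by
  have habs : |Real.sin ((m : ℝ) * h)| ≤ m * |Real.sin h| := by
    induction m with
    | zero => simp
    | succ m ih =>
      push_cast
      rw [add_mul, one_mul, Real.sin_add, add_mul, one_mul]
      refine (abs_add_le _ _).trans (add_le_add ?_ ?_)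
      · rw [abs_mul]
        exact (mul_le_of_le_one_right (abs_nonneg _) (Real.abs_cos_le_one _)).trans ih
      · rw [abs_mul]
        exact mul_le_of_le_one_left (abs_nonneg _) (Real.abs_cos_le_one _)
  rw [abs_of_nonneg hs] at habs
  exact (le_abs_self _).trans habs

/-- The modified Jackson filter lies in `[0,1]` and deviates from `1` by at most
`C β² / (n+1)²` for an absolute constant `C`. -/
theorem jackson_filter_bounds :
    ∃ C > (0 : ℝ), ∀ n : ℕ, 1 ≤ n → ∀ β : ℤ, |β| ≤ (n : ℤ) →
      0 ≤ jackson n β ∧ jackson n β ≤ 1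
        ∧ 1 - jackson n β ≤ C * (β : ℝ) ^ 2 / ((n : ℝ) + 1) ^ 2 := by
  refine ⟨3 * Real.pi ^ 2, by positivity, fun n hn β hβ => ?_⟩
  obtain ⟨b, hb⟩ : ∃ b : ℕ, |β| = b := ⟨β.natAbs, Int.abs_eq_natAbs β⟩
  have hbR : |(β : ℝ)| = b := by exact_mod_cast congrArg (Int.cast : ℤ → ℝ) hb
  have hbn : b ≤ n := by rw [hb] at hβ; exact_mod_cast hβ
  obtain ⟨m, rfl⟩ := Nat.exists_eq_add_of_le hbn
  rw [← sq_abs (β : ℝ)]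
  simp only [jackson, hbR]
  set N : ℝ := ((b + m : ℕ) : ℝ) + 1 with hN
  have hNm : N = b + m + 1 := by rw [hN]; push_cast; ring
  have hN2 : 2 ≤ N := by
    have : (1 : ℝ) ≤ ((b + m : ℕ) : ℝ) := by exact_mod_cast hn
    linarith
  have hN0 : 0 < N := by linarith
  have hb0 : (0 : ℝ) ≤ b := b.cast_nonneg
  have hm0 : (0 : ℝ) ≤ m := m.cast_nonneg
  rw [show Real.pi * b / N = b * (Real.pi / N) by ring]
  set h : ℝ := Real.pi / N with hh
  have hNh : N * h = Real.pi := by rw [hh]; field_simp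
  have hpos : 0 < h := div_pos Real.pi_pos hN0
  have h2 : h ≤ Real.pi / 2 := div_le_div_of_nonneg_left Real.pi_pos.le two_pos hN2
  have hs : 0 < Real.sin h := Real.sin_pos_of_pos_of_lt_pi hpos (by linarith [Real.pi_pos])
  have hc : 0 ≤ Real.cos h :=
    Real.cos_nonneg_of_neg_pi_div_two_le_of_le (by linarith [Real.pi_pos]) h2
  rw [Real.cot_eq_cos_div_sin]
  refine ⟨div_nonneg ?_ hN0.le, (div_le_one hN0).2 ?_, ?_⟩
  · have key := nat_mul_cos_mul_sin_le_sin hpos.le m (by nlinarith)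
    have hbh : (b : ℝ) * h = Real.pi - (m + 1) * h := by rw [← hNh, hNm]; ring
    have hsin : Real.sin (m * h) = Real.sin ((m + 1) * h) * Real.cos h
        - Real.cos ((m + 1) * h) * Real.sin h := by
      rw [← Real.sin_sub]; ring_nf
    have hcot : (m + 1) * Real.cos ((m + 1) * h)
        ≤ Real.sin ((m + 1) * h) * (Real.cos h / Real.sin h) := by
      rw [← mul_div_assoc (Real.sin _), le_div_iff₀ hs]
      linarith
    rw [hbh, Real.cos_pi_sub, Real.sin_pi_sub, show N - b = m + 1 by rw [hNm]; ring]
    linarith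
  · have hsin : Real.sin (b * h) * (Real.cos h / Real.sin h) ≤ b := by
      rw [← mul_div_assoc (Real.sin _), div_le_iff₀ hs]
      exact (mul_le_mul_of_nonneg_right (sin_nat_mul_le b hs.le) hc).trans
        (mul_le_of_le_one_right (by positivity) (Real.cos_le_one h))
    have hcos : (N - b) * Real.cos (b * h) ≤ N - b :=
      mul_le_of_le_one_right (by linarith) (Real.cos_le_one _)
    linarith
  · have key := nat_mul_cos_mul_sin_le_sin hpos.le b (by nlinarith)
    have hcot : b * (Real.cos ((b + 1) * h) * Real.cos h)
        ≤ Real.sin (b * h) * (Real.cos h / Real.sin h) := by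
      rw [← mul_div_assoc (Real.sin _), le_div_iff₀ hs]
      nlinarith [mul_le_mul_of_nonneg_right key hc]
    have hprod : Real.cos (b * h) + Real.cos ((b + 2) * h)
        = 2 * (Real.cos ((b + 1) * h) * Real.cos h) := by
      rw [show (b : ℝ) * h = (b + 1) * h - h by ring,
        show ((b : ℝ) + 2) * h = (b + 1) * h + h by ring, Real.cos_sub, Real.cos_add]
      ring
    have hcos₁ := Real.one_sub_sq_div_two_le_cos (x := b * h)
    have hcos₂ := Real.one_sub_sq_div_two_le_cos (x := (b + 2) * h)
    have hcos : (N - b) * (1 - Real.cos (b * h)) ≤ N * ((b * h) ^ 2 / 2) :=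
      mul_le_mul (by linarith) (by linarith) (by linarith [Real.cos_le_one (b * h)]) hN0.le
    have hsin : b * (1 - Real.cos ((b + 1) * h) * Real.cos h) ≤ N * (5 / 2 * (b * h) ^ 2) := by
      rcases Nat.eq_zero_or_pos b with rfl | hb1
      · simp
      · have hb1' : (1 : ℝ) ≤ b := by exact_mod_cast hb1
        have hsq : (((b : ℝ) + 2) * h) ^ 2 ≤ (3 * b * h) ^ 2 := by
          gcongr
          linarith
        refine (mul_le_mul_of_nonneg_left (b := 1 - _) (c := 5 / 2 * (b * h) ^ 2) ?_ hb0).trans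
          (mul_le_mul_of_nonneg_right (by linarith) (by positivity))
        nlinarith
    rw [show 3 * Real.pi ^ 2 * (b : ℝ) ^ 2 / N ^ 2 = 3 * (b * h) ^ 2 by rw [← hNh]; field_simp,
      one_sub_div hN0.ne', div_le_iff₀ hN0]
    linarith
end
end

section
/- With the classical-form kernel modes B̂(l,m) = ∫_{B_R} ∫_{S^{d−1}} B(g,ω) E_l((g+|g|ω)/2) E_m((g−|g|ω)/2) dω dg, where B(g,ω) = b(|g|, |g·ω|/|g|) with b bounded, measurable and non-negative, every B̂(l,m) is a real number, and the symmetry relations B̂(l,m) = B̂(m,l), B̂(l,m) = B̂(l,−m) and B̂(l,m) = B̂(−l,−m) hold for all l,m ∈ ℤ^d. -/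
open scoped BigOperators RealInnerProductSpace
open MeasureTheory Metric

noncomputable section

/-- The Fourier character `E_k(v) = exp(iπ (k·v)/T)` on `ℝ^d`. -/
def Ek (d : ℕ) (T : ℝ) (k : Fin d → ℤ) (v : EuclideanSpace ℝ (Fin d)) : ℂ :=
  Complex.exp (Complex.I * (Real.pi : ℂ) * ((∑ i, (k i : ℝ) * v i : ℝ) : ℂ) / (T : ℂ))

/-- The classical-form kernel modes
`B̂(l,m) = ∫_{B_R} ∫_{S^{d−1}} B(g,ω) E_l((g+|g|ω)/2) E_m((g−|g|ω)/2) dω dg`,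
where `B(g,ω) = b(|g|, |g·ω|/|g|)` and the sphere carries its surface measure. -/
def Bhat (d : ℕ) (R T : ℝ) (b : ℝ → ℝ → ℝ) (l m : Fin d → ℤ) : ℂ :=
  ∫ g in closedBall (0 : EuclideanSpace ℝ (Fin d)) R,
    ∫ ω : sphere (0 : EuclideanSpace ℝ (Fin d)) 1,
      ((b ‖g‖ (|⟪g, (ω : EuclideanSpace ℝ (Fin d))⟫| / ‖g‖) : ℝ) : ℂ)
        * Ek d T l ((1 / 2 : ℝ) • (g + ‖g‖ • (ω : EuclideanSpace ℝ (Fin d))))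
        * Ek d T m ((1 / 2 : ℝ) • (g - ‖g‖ • (ω : EuclideanSpace ℝ (Fin d))))
      ∂((volume : Measure (EuclideanSpace ℝ (Fin d))).toSphere)

section Sphere

/-- Polar coordinates `(σ, r) ↦ r σ`. -/
def polarMap (E : Type*) [NormedAddCommGroup E] [NormedSpace ℝ E]
    (p : sphere (0 : E) 1 × Set.Ioi (0 : ℝ)) : E :=
  (p.2 : ℝ) • (p.1 : E)

lemma polarMap_eq (E : Type*) [NormedAddCommGroup E] [NormedSpace ℝ E] :
    polarMap E = Subtype.val ∘ (homeomorphUnitSphereProd E).symm := by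
  ext p
  simp [polarMap]

variable {E : Type*} [NormedAddCommGroup E] [NormedSpace ℝ E] [MeasurableSpace E] [BorelSpace E]
  [FiniteDimensional ℝ E] (μ : Measure E) [μ.IsAddHaarMeasure]
  {F : Type*} [NormedAddCommGroup F] [NormedSpace ℝ F]

lemma measurePreserving_neg_toSphere :
    MeasurePreserving (fun ω : sphere (0 : E) 1 => -ω) μ.toSphere μ.toSphere := by
  have hm : Measurable (fun ω : sphere (0 : E) 1 => -ω) := continuous_neg.measurable
  refine ⟨hm, Measure.ext fun s hs => ?_⟩
  rw [Measure.map_apply hm hs, μ.toSphere_apply' hs, μ.toSphere_apply' (hm hs)]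
  congr 1
  rw [← Measure.measure_neg μ]
  congr 1
  ext x
  simp only [Set.mem_neg, Set.mem_smul, Set.mem_image, Set.mem_preimage]
  constructor
  · rintro ⟨r, hr, _, ⟨ω, hω, rfl⟩, h⟩
    exact ⟨r, hr, _, ⟨-ω, hω, rfl⟩, by simp [h]⟩
  · rintro ⟨r, hr, _, ⟨ω, hω, rfl⟩, rfl⟩
    exact ⟨r, hr, _, ⟨-ω, by simpa using hω, rfl⟩, by simp⟩

lemma integral_neg_toSphere (f : sphere (0 : E) 1 → F) :
    ∫ ω, f (-ω) ∂μ.toSphere = ∫ ω, f ω ∂μ.toSphere :=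
  (measurePreserving_neg_toSphere μ).integral_comp (Homeomorph.neg _).measurableEmbedding f

lemma measurableEmbedding_polarMap : MeasurableEmbedding (polarMap E) := by
  rw [polarMap_eq]
  exact (MeasurableEmbedding.subtype_coe (measurableSet_singleton _).compl).comp
    (Homeomorph.measurableEmbedding _)

lemma measurePreserving_polarMap [Nontrivial E] :
    MeasurePreserving (polarMap E)
      (μ.toSphere.prod (Measure.volumeIoiPow (Module.finrank ℝ E - 1))) μ := by
  rw [polarMap_eq]
  have h₁ : MeasurePreserving (Subtype.val : ({0}ᶜ : Set E) → E) (μ.comap (↑)) μ := by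
    refine ⟨measurable_subtype_coe, ?_⟩
    rw [map_comap_subtype_coe (measurableSet_singleton _).compl, restrict_compl_singleton]
  exact h₁.comp (MeasurePreserving.symm (homeomorphUnitSphereProd E).toMeasurableEquiv
    μ.measurePreserving_homeomorphUnitSphereProd)

/-- In polar coordinates, the direction of the first variable may be exchanged with a second
variable ranging over the sphere. -/
lemma integral_integral_toSphere_of_swap [Nontrivial E] {K L : E → sphere (0 : E) 1 → F}
    (hK : Integrable (Function.uncurry K) (μ.prod μ.toSphere))
    (hKL : ∀ r : ℝ, 0 < r → ∀ σ ω : sphere (0 : E) 1, K (r • (σ : E)) ω = L (r • (ω : E)) σ) :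
    ∫ g, ∫ ω, K g ω ∂μ.toSphere ∂μ = ∫ g, ∫ ω, L g ω ∂μ.toSphere ∂μ := by
  set ν := Measure.volumeIoiPow (Module.finrank ℝ E - 1)
  have hpol := measurePreserving_polarMap μ
  have hKint : Integrable (fun q : (sphere (0 : E) 1 × Set.Ioi (0 : ℝ)) × sphere (0 : E) 1 =>
      K (polarMap E q.1) q.2) ((μ.toSphere.prod ν).prod μ.toSphere) :=
    (hpol.prod (MeasurePreserving.id μ.toSphere)).integrable_comp_of_integrable hK
  have hperm : MeasurePreserving
      (fun q : (sphere (0 : E) 1 × Set.Ioi (0 : ℝ)) × sphere (0 : E) 1 => ((q.2, q.1.2), q.1.1))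
      ((μ.toSphere.prod ν).prod μ.toSphere) ((μ.toSphere.prod ν).prod μ.toSphere) :=
    ((Measure.measurePreserving_swap (μ := ν) (ν := μ.toSphere)).prod
      (MeasurePreserving.id μ.toSphere)).comp
      ((Measure.measurePreserving_swap (μ := μ.toSphere) (ν := ν.prod μ.toSphere)).comp
        (measurePreserving_prodAssoc μ.toSphere ν μ.toSphere))
  have hLK (q : (sphere (0 : E) 1 × Set.Ioi (0 : ℝ)) × sphere (0 : E) 1) :
      L (polarMap E q.1) q.2 = K (polarMap E (q.2, q.1.2)) q.1.1 :=
    (hKL _ q.1.2.2 _ _).symm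
  have hLint : Integrable (fun q : (sphere (0 : E) 1 × Set.Ioi (0 : ℝ)) × sphere (0 : E) 1 =>
      L (polarMap E q.1) q.2) ((μ.toSphere.prod ν).prod μ.toSphere) := by
    simp only [hLK]
    exact hperm.integrable_comp_of_integrable hKint
  rw [← hpol.integral_comp measurableEmbedding_polarMap,
    ← hpol.integral_comp measurableEmbedding_polarMap, ← integral_prod _ hKint,
    ← integral_prod _ hLint]
  simp only [hLK]
  have h := hKint.aestronglyMeasurable
  conv_lhs => rw [← hperm.map_eq]
  rw [integral_map hperm.aemeasurable (by rwa [hperm.map_eq])]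

end Sphere

section Modes

variable {d : ℕ} {R T : ℝ} {b : ℝ → ℝ → ℝ}

lemma norm_Ek (k : Fin d → ℤ) (v : EuclideanSpace ℝ (Fin d)) : ‖Ek d T k v‖ = 1 := by
  have : Ek d T k v = Complex.exp (((Real.pi * (∑ i, (k i : ℝ) * v i) / T : ℝ) : ℂ)
      * Complex.I) := by
    unfold Ek
    congr 1
    push_cast
    ring
  rw [this, Complex.norm_exp_ofReal_mul_I]

@[fun_prop]
lemma continuous_Ek (k : Fin d → ℤ) : Continuous (Ek d T k) := by
  unfold Ek
  fun_prop

lemma conj_Ek (k : Fin d → ℤ) (v : EuclideanSpace ℝ (Fin d)) :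
    (starRingEnd ℂ) (Ek d T k v) = Ek d T (-k) v := by
  unfold Ek
  rw [← Complex.exp_conj]
  simp only [map_div₀, map_mul, Complex.conj_I, Complex.conj_ofReal, Pi.neg_apply, Int.cast_neg,
    neg_mul, Finset.sum_neg_distrib, Complex.ofReal_neg, mul_neg]

lemma Ek_neg_left (k : Fin d → ℤ) (v : EuclideanSpace ℝ (Fin d)) :
    Ek d T (-k) v = Ek d T k (-v) := by
  simp [Ek]

/-- The integrand of the kernel modes. -/
def modeIntegrand (T : ℝ) (b : ℝ → ℝ → ℝ) (l m : Fin d → ℤ) (g : EuclideanSpace ℝ (Fin d))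
    (ω : sphere (0 : EuclideanSpace ℝ (Fin d)) 1) : ℂ :=
  ((b ‖g‖ (|⟪g, (ω : EuclideanSpace ℝ (Fin d))⟫| / ‖g‖) : ℝ) : ℂ)
    * Ek d T l ((1 / 2 : ℝ) • (g + ‖g‖ • (ω : EuclideanSpace ℝ (Fin d))))
    * Ek d T m ((1 / 2 : ℝ) • (g - ‖g‖ • (ω : EuclideanSpace ℝ (Fin d))))

lemma Bhat_eq_modeIntegrand (l m : Fin d → ℤ) :
    Bhat d R T b l m = ∫ g in closedBall (0 : EuclideanSpace ℝ (Fin d)) R,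
      ∫ ω, modeIntegrand T b l m g ω
        ∂((volume : Measure (EuclideanSpace ℝ (Fin d))).toSphere) := rfl

lemma modeIntegrand_neg_right (l m : Fin d → ℤ) (g : EuclideanSpace ℝ (Fin d))
    (ω : sphere (0 : EuclideanSpace ℝ (Fin d)) 1) :
    modeIntegrand T b l m g (-ω) = modeIntegrand T b m l g ω := by
  simp only [modeIntegrand, coe_neg_sphere, inner_neg_right, abs_neg, smul_neg, sub_neg_eq_add,
    ← sub_eq_add_neg]
  ring

lemma modeIntegrand_neg_left (l m : Fin d → ℤ) (g : EuclideanSpace ℝ (Fin d))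
    (ω : sphere (0 : EuclideanSpace ℝ (Fin d)) 1) :
    modeIntegrand T b l m (-g) ω = modeIntegrand T b (-m) (-l) g ω := by
  simp only [modeIntegrand, Ek_neg_left, norm_neg, inner_neg_left, abs_neg, ← smul_neg]
  rw [show -(g + ‖g‖ • (ω : EuclideanSpace ℝ (Fin d))) = -g - ‖g‖ • (ω : EuclideanSpace ℝ (Fin d))
    by abel, show -(g - ‖g‖ • (ω : EuclideanSpace ℝ (Fin d)))
      = -g + ‖g‖ • (ω : EuclideanSpace ℝ (Fin d)) by abel]
  ring

lemma conj_modeIntegrand (l m : Fin d → ℤ) (g : EuclideanSpace ℝ (Fin d))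
    (ω : sphere (0 : EuclideanSpace ℝ (Fin d)) 1) :
    (starRingEnd ℂ) (modeIntegrand T b l m g ω) = modeIntegrand T b (-l) (-m) g ω := by
  simp only [modeIntegrand, map_mul, Complex.conj_ofReal, conj_Ek]

lemma modeIntegrand_swap (l m : Fin d → ℤ) {r : ℝ} (hr : 0 < r)
    (σ ω : sphere (0 : EuclideanSpace ℝ (Fin d)) 1) :
    modeIntegrand T b l m (r • (σ : EuclideanSpace ℝ (Fin d))) ω
      = modeIntegrand T b l (-m) (r • (ω : EuclideanSpace ℝ (Fin d))) σ := by
  have hn (τ : sphere (0 : EuclideanSpace ℝ (Fin d)) 1) :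
      ‖r • (τ : EuclideanSpace ℝ (Fin d))‖ = r := by
    simp [norm_smul, abs_of_pos hr]
  simp only [modeIntegrand, Ek_neg_left, hn, ← smul_neg, neg_sub, real_inner_smul_left]
  rw [real_inner_comm, add_comm (r • (σ : EuclideanSpace ℝ (Fin d)))]

lemma Bhat_comm (l m : Fin d → ℤ) : Bhat d R T b l m = Bhat d R T b m l := by
  simp only [Bhat_eq_modeIntegrand]
  refine integral_congr_ae (.of_forall fun g => ?_)
  simp only
  rw [← integral_neg_toSphere]
  simp only [modeIntegrand_neg_right]

lemma Bhat_neg_neg (l m : Fin d → ℤ) : Bhat d R T b (-l) (-m) = Bhat d R T b l m := by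
  rw [Bhat_comm l m]
  simp only [Bhat_eq_modeIntegrand]
  rw [← integral_indicator measurableSet_closedBall, ← integral_indicator measurableSet_closedBall,
    ← integral_neg_eq_self]
  congr 1 with g
  by_cases hg : ‖g‖ ≤ R
  · rw [Set.indicator_of_mem (by simpa using hg), Set.indicator_of_mem (by simpa using hg)]
    simp only [modeIntegrand_neg_left, neg_neg]
  · rw [Set.indicator_of_notMem (by simpa using hg), Set.indicator_of_notMem (by simpa using hg)]

lemma conj_Bhat (l m : Fin d → ℤ) :
    (starRingEnd ℂ) (Bhat d R T b l m) = Bhat d R T b (-l) (-m) := by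
  simp only [Bhat_eq_modeIntegrand, ← integral_conj, conj_modeIntegrand]

lemma integrable_modeIntegrand (hb_meas : Measurable (Function.uncurry b))
    (hb_bdd : ∃ M : ℝ, ∀ x y : ℝ, b x y ≤ M) (hb_nonneg : ∀ x y : ℝ, 0 ≤ b x y)
    (l m : Fin d → ℤ) :
    Integrable (Function.uncurry fun g => (closedBall 0 R).indicator (modeIntegrand T b l m) g)
      ((volume : Measure (EuclideanSpace ℝ (Fin d))).prod volume.toSphere) := by
  obtain ⟨M, hM⟩ := hb_bdd
  have hmeas : Measurable (Function.uncurry (modeIntegrand (d := d) T b l m)) := by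
    have hb : Measurable fun p : EuclideanSpace ℝ (Fin d) × sphere (0 : EuclideanSpace ℝ (Fin d)) 1
        => b ‖p.1‖ (|⟪p.1, (p.2 : EuclideanSpace ℝ (Fin d))⟫| / ‖p.1‖) := by
      refine hb_meas.comp (Measurable.prodMk (by fun_prop) (Measurable.div ?_ (by fun_prop)))
      exact Continuous.measurable (by fun_prop)
    refine ((Complex.measurable_ofReal.comp hb).mul ?_).mul ?_ <;>
      exact Continuous.measurable (by fun_prop)
  have hind : (Function.uncurry fun g => (closedBall 0 R).indicator (modeIntegrand T b l m) g)
      = (closedBall (0 : EuclideanSpace ℝ (Fin d)) R ×ˢ Set.univ).indicator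
        (Function.uncurry (modeIntegrand T b l m)) := by
    ext ⟨g, ω⟩
    by_cases hg : g ∈ closedBall (0 : EuclideanSpace ℝ (Fin d)) R <;>
      simp [Function.uncurry, Set.indicator, hg]
  rw [hind, integrable_indicator_iff (measurableSet_closedBall.prod .univ), IntegrableOn,
    ← Measure.prod_restrict, Measure.restrict_univ]
  have : IsFiniteMeasure ((volume : Measure (EuclideanSpace ℝ (Fin d))).restrict
      (closedBall 0 R)) := isFiniteMeasure_restrict.2 measure_closedBall_lt_top.ne
  refine Integrable.of_bound hmeas.aestronglyMeasurable M (.of_forall fun p => ?_)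
  simpa [Function.uncurry, modeIntegrand, norm_Ek, abs_of_nonneg (hb_nonneg _ _)] using hM _ _

lemma Bhat_neg_right [NeZero d] (hb_meas : Measurable (Function.uncurry b))
    (hb_bdd : ∃ M : ℝ, ∀ x y : ℝ, b x y ≤ M) (hb_nonneg : ∀ x y : ℝ, 0 ≤ b x y)
    (l m : Fin d → ℤ) : Bhat d R T b l m = Bhat d R T b l (-m) := by
  have h (m : Fin d → ℤ) : Bhat d R T b l m = ∫ g : EuclideanSpace ℝ (Fin d),
      ∫ ω, (closedBall 0 R).indicator (modeIntegrand T b l m) g ω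
        ∂(volume : Measure (EuclideanSpace ℝ (Fin d))).toSphere := by
    rw [Bhat_eq_modeIntegrand, ← integral_indicator measurableSet_closedBall]
    congr 1 with g
    by_cases hg : g ∈ closedBall (0 : EuclideanSpace ℝ (Fin d)) R
    · simp only [Set.indicator_of_mem hg]
    · simp only [Set.indicator_of_notMem hg, Pi.zero_apply, integral_zero]
  rw [h, h]
  refine integral_integral_toSphere_of_swap volume
    (integrable_modeIntegrand hb_meas hb_bdd hb_nonneg l m) fun r hr σ ω => ?_
  have hn (τ : sphere (0 : EuclideanSpace ℝ (Fin d)) 1) :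
      r • (τ : EuclideanSpace ℝ (Fin d)) ∈ closedBall 0 R ↔ r ≤ R := by
    simp [norm_smul, abs_of_pos hr]
  by_cases hrR : r ≤ R
  · rw [Set.indicator_of_mem ((hn σ).2 hrR), Set.indicator_of_mem ((hn ω).2 hrR)]
    exact modeIntegrand_swap l m hr σ ω
  · rw [Set.indicator_of_notMem (mt (hn σ).1 hrR), Set.indicator_of_notMem (mt (hn ω).1 hrR)]
    rfl

end Modes

/-- The classical-form kernel modes are real and satisfy the symmetry relations. -/
theorem Bhat_real_and_symm (d : ℕ) (hd : 2 ≤ d) (R T : ℝ) (hR : 0 < R) (hT : 0 < T)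
    (b : ℝ → ℝ → ℝ) (hb_meas : Measurable (Function.uncurry b))
    (hb_bdd : ∃ M : ℝ, ∀ x y : ℝ, b x y ≤ M) (hb_nonneg : ∀ x y : ℝ, 0 ≤ b x y)
    (l m : Fin d → ℤ) :
    (Bhat d R T b l m).im = 0
      ∧ Bhat d R T b l m = Bhat d R T b m l
      ∧ Bhat d R T b l m = Bhat d R T b l (-m)
      ∧ Bhat d R T b l m = Bhat d R T b (-l) (-m) := by
  have : NeZero d := ⟨by lia⟩
  refine ⟨?_, Bhat_comm l m, Bhat_neg_right hb_meas hb_bdd hb_nonneg l m, (Bhat_neg_neg l m).symm⟩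
  rw [← Complex.conj_eq_iff_im, conj_Bhat, Bhat_neg_neg]
end
end
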